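/- Let λ > 0, β₁ > 0 and let γ, ξ* be real numbers with ξ* + γ − 2 > 0. For x > 0 define u(x) = ∫_1^∞ e^{−λ x t/β₁} (t−1)^{ξ*+γ−3} t^{1−γ} dt. Then this integral converges for every x > 0, u is twice continuously differentiable on (0,∞), and u satisfies β₁ x u''(x) + (λ x + β₁ ξ*) u'(x) − λ(γ−2) u(x) = 0 for all x > 0. -/

import Mathlib

open MeasureTheory

/-- The integrand. -/
noncomputable def lapK (lam β s b x t : ℝ) : ℝ :=
  Real.exp (-(lam * x * t) / β) * (t - 1) ^ s * t ^ b

/-- The integral. -/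
noncomputable def lapJ (lam β s b x : ℝ) : ℝ :=
  ∫ t in Set.Ioi (1:ℝ), lapK lam β s b x t

lemma lapK_meas (lam β s b x : ℝ) : Measurable (lapK lam β s b x) := by
  unfold lapK
  fun_prop

lemma lap_rpow_bound (b ε : ℝ) (hε : 0 < ε) :
    ∃ C : ℝ, ∀ t : ℝ, 1 ≤ t → t ^ b ≤ C * Real.exp (ε * t) := by
  obtain ⟨n, hn⟩ := exists_nat_ge b
  refine ⟨(n.factorial : ℝ) / ε ^ n, fun t ht => ?_⟩
  have h1 : t ^ b ≤ t ^ n := by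
    rw [← Real.rpow_natCast]
    exact Real.rpow_le_rpow_of_exponent_le ht hn
  have h2 := Real.pow_div_factorial_le_exp (ε * t) (by positivity) n
  have hf : (0:ℝ) < n.factorial := by positivity
  rw [div_le_iff₀ hf, mul_pow] at h2
  refine h1.trans ?_
  rw [div_mul_eq_mul_div, le_div_iff₀ (by positivity)]
  linarith

lemma lapK_int (lam β s b x : ℝ) (hl : 0 < lam) (hβ : 0 < β) (hs : -1 < s) (hx : 0 < x) :
    IntegrableOn (lapK lam β s b x) (Set.Ioi 1) := by
  set c := lam * x / β with hc
  have hcpos : 0 < c := by positivity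
  obtain ⟨C, hC⟩ := lap_rpow_bound b (c / 2) (by positivity)
  have h0 : IntegrableOn (fun t : ℝ => t ^ s * Real.exp (-(c/2) * t)) (Set.Ioi 0) := by
    have := integrableOn_rpow_mul_exp_neg_mul_rpow (p := 1) (s := s) (b := c / 2) hs one_pos
      (by positivity)
    simpa using this
  have h1 : IntegrableOn (fun t : ℝ => (t-1) ^ s * Real.exp (-(c/2) * (t-1))) (Set.Ioi 1) := by
    have := ((measurePreserving_sub_right (volume : Measure ℝ) 1).integrableOn_comp_preimage
      (MeasurableEquiv.subRight (1:ℝ)).measurableEmbedding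
      (f := fun t : ℝ => t ^ s * Real.exp (-(c/2) * t)) (s := Set.Ioi 0)).2 h0
    simpa [Function.comp_def] using this
  refine Integrable.mono' (h1.const_mul (C * Real.exp (-(c/2))))
    (lapK_meas lam β s b x).aestronglyMeasurable ?_
  refine (ae_restrict_iff' measurableSet_Ioi).2 (Filter.Eventually.of_forall fun t ht => ?_)
  have ht1 : (1:ℝ) < t := ht
  have hp : 0 ≤ (t - 1) ^ s := Real.rpow_nonneg (by linarith) _
  have hq : 0 ≤ t ^ b := Real.rpow_nonneg (by linarith) _
  have hk : 0 ≤ lapK lam β s b x t := by unfold lapK; positivity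
  rw [Real.norm_of_nonneg hk]
  unfold lapK
  have e1 : -(lam * x * t) / β = -(c * t) := by rw [hc]; ring
  rw [e1]
  calc Real.exp (-(c * t)) * (t - 1) ^ s * t ^ b
      ≤ Real.exp (-(c * t)) * (t - 1) ^ s * (C * Real.exp (c / 2 * t)) := by
        gcongr
        exact hC t ht1.le
    _ = C * (t-1)^s * (Real.exp (-(c * t)) * Real.exp (c / 2 * t)) := by ring
    _ = C * (t-1)^s * (Real.exp (-(c/2)) * Real.exp (-(c/2) * (t-1))) := by
        rw [← Real.exp_add, ← Real.exp_add]; ring_nf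
    _ = _ := by ring

lemma lapJ_deriv (lam β s b x : ℝ) (hl : 0 < lam) (hβ : 0 < β) (hs : -1 < s) (hx : 0 < x) :
    HasDerivAt (lapJ lam β s b) (-(lam/β) * lapJ lam β s (b+1) x) x := by
  have key := hasDerivAt_integral_of_dominated_loc_of_deriv_le
    (μ := volume.restrict (Set.Ioi (1:ℝ)))
    (F := fun y t => lapK lam β s b y t)
    (F' := fun y t => -(lam/β) * lapK lam β s (b+1) y t)
    (x₀ := x) (s := Set.Ioi (x/2))
    (bound := fun t => (lam/β) * lapK lam β s (b+1) (x/2) t)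
    (Ioi_mem_nhds (by linarith))
    (Filter.Eventually.of_forall fun y => (lapK_meas lam β s b y).aestronglyMeasurable)
    (lapK_int lam β s b x hl hβ hs hx)
    ((lapK_meas lam β s (b+1) x).const_mul _).aestronglyMeasurable
    ?_ ((lapK_int lam β s (b+1) (x/2) hl hβ hs (by positivity)).const_mul _) ?_
  · have := key.2
    rw [integral_const_mul] at this
    exact this
  · refine (ae_restrict_iff' measurableSet_Ioi).2 (Filter.Eventually.of_forall fun t ht y hy => ?_)
    have ht1 : (1:ℝ) < t := ht
    have hy1 : x / 2 < y := hy
    have hp : 0 ≤ (t - 1) ^ s := Real.rpow_nonneg (by linarith) _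
    have hq : 0 ≤ t ^ (b+1) := Real.rpow_nonneg (by linarith) _
    have hk : 0 ≤ lapK lam β s (b+1) y t := by unfold lapK; positivity
    rw [norm_mul, norm_neg, Real.norm_of_nonneg hk, Real.norm_of_nonneg (by positivity)]
    unfold lapK
    have : 0 < t := by linarith
    gcongr
  · refine (ae_restrict_iff' measurableSet_Ioi).2 (Filter.Eventually.of_forall fun t ht y hy => ?_)
    have ht1 : (1:ℝ) < t := ht
    unfold lapK
    have h1 : HasDerivAt (fun y : ℝ => -(lam * y * t) / β) (-(lam * 1 * t) / β) y :=
      ((((hasDerivAt_id y).const_mul lam).mul_const t).neg).div_const β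
    have h2 := (h1.exp.mul_const ((t-1)^s)).mul_const (t ^ b)
    refine h2.congr_deriv ?_
    rw [Real.rpow_add_one (by linarith)]
    ring

lemma lapJ_contDiff (lam β s : ℝ) (hl : 0 < lam) (hβ : 0 < β) (hs : -1 < s) (n : ℕ) :
    ∀ b, ContDiffOn ℝ n (lapJ lam β s b) (Set.Ioi 0) := by
  induction n with
  | zero =>
    intro b
    exact contDiffOn_zero.2 fun x hx =>
      (lapJ_deriv lam β s b x hl hβ hs hx).continuousAt.continuousWithinAt
  | succ n ih =>
    intro b
    push_cast
    rw [contDiffOn_succ_iff_deriv_of_isOpen isOpen_Ioi]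
    refine ⟨fun x hx =>
      (lapJ_deriv lam β s b x hl hβ hs hx).differentiableAt.differentiableWithinAt, by simp, ?_⟩
    refine (contDiffOn_const.mul (ih (b+1)) : ContDiffOn ℝ n
      (fun x => -(lam/β) * lapJ lam β s (b+1) x) (Set.Ioi 0)).congr fun x hx => ?_
    exact (lapJ_deriv lam β s b x hl hβ hs hx).deriv

lemma lap_parts (lam β s b x : ℝ) (hl : 0 < lam) (hβ : 0 < β) (hs : -1 < s) (hx : 0 < x) :
    (-(lam * x / β)) * lapJ lam β s (b+1+1) x + (lam * x / β + (s + 1) + (b + 1)) *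
      lapJ lam β s (b+1) x - (b+1) * lapJ lam β s b x = 0 := by
  have i0 := lapK_int lam β s b x hl hβ hs hx
  have i1 := lapK_int lam β s (b+1) x hl hβ hs hx
  have i2 := lapK_int lam β s (b+1+1) x hl hβ hs hx
  have i3 := ((i2.const_mul (-(lam * x / β))).add
    (i1.const_mul (lam * x / β + (s + 1) + (b + 1)))).sub (i0.const_mul (b+1))
  have ftc := integral_Ioi_of_hasDerivAt_of_tendsto
    (f := fun t => lapK lam β (s+1) (b+1) x t) (a := 1) (m := 0) ?_ ?_ i3 ?_
  · simp only [Pi.sub_apply, Pi.add_apply] at ftc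
    rw [integral_sub, integral_add, integral_const_mul, integral_const_mul,
      integral_const_mul] at ftc
    · unfold lapJ
      rw [ftc]
      unfold lapK
      simp [Real.zero_rpow (show s + 1 ≠ 0 by linarith)]
    · exact i2.const_mul _
    · exact i1.const_mul _
    · exact (i2.const_mul _).add (i1.const_mul _)
    · exact i0.const_mul _
  · apply ContinuousAt.continuousWithinAt
    unfold lapK
    refine ContinuousAt.mul (ContinuousAt.mul (by fun_prop) ?_) ?_
    · exact ContinuousAt.rpow_const (by fun_prop) (Or.inr (by linarith))
    · exact ContinuousAt.rpow_const (by fun_prop) (Or.inl (by norm_num))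
  · intro t ht
    have ht1 : (1:ℝ) < t := ht
    have h1 : HasDerivAt (fun t : ℝ => -(lam * x * t) / β) (-(lam * x * 1) / β) t :=
      (((hasDerivAt_id t).const_mul (lam * x)).neg).div_const β
    have h2 : HasDerivAt (fun t : ℝ => (t-1)^(s+1)) (1 * (s+1) * (t-1)^(s+1-1)) t :=
      ((hasDerivAt_id t).sub_const 1).rpow_const (Or.inl (by simp; linarith))
    have h3 : HasDerivAt (fun t : ℝ => t^(b+1)) (1 * (b+1) * t^(b+1-1)) t :=
      (hasDerivAt_id t).rpow_const (Or.inl (by simp; linarith))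
    have h4 := (h1.exp.mul h2).mul h3
    refine h4.congr_deriv ?_
    simp only [Pi.sub_apply, Pi.add_apply, Pi.mul_apply, lapK, add_sub_cancel_right]
    rw [Real.rpow_add_one (x := t) (by linarith) (b+1), Real.rpow_add_one (x := t) (by linarith) b,
      Real.rpow_add_one (x := t-1) (by linarith) s]
    ring
  · have hc : 0 < lam * x / β := by positivity
    have h := tendsto_rpow_mul_exp_neg_mul_atTop_nhds_zero (s+1+(b+1)) (lam*x/β) hc
    refine squeeze_zero_norm' ?_ h
    filter_upwards [Filter.eventually_gt_atTop 1] with t ht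
    have hp : 0 ≤ (t - 1) ^ (s+1) := Real.rpow_nonneg (by linarith) _
    have hq : 0 ≤ t ^ (b+1) := Real.rpow_nonneg (by linarith) _
    have hk : 0 ≤ lapK lam β (s+1) (b+1) x t := by unfold lapK; positivity
    rw [Real.norm_of_nonneg hk, Real.rpow_add (by linarith)]
    unfold lapK
    have e1 : -(lam * x * t) / β = -(lam * x / β) * t := by ring
    have e2 : (t-1)^(s+1) ≤ t^(s+1) :=
      Real.rpow_le_rpow (by linarith) (by linarith) (by linarith)
    rw [e1]
    calc _ ≤ Real.exp (-(lam * x / β) * t) * t ^ (s+1) * t ^ (b+1) := by gcongr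
      _ = _ := by ring



/-- For `λ > 0`, `β₁ > 0` and `ξ* + γ - 2 > 0`, the function
`u(x) = ∫_1^∞ e^{-λxt/β₁} (t-1)^(ξ*+γ-3) t^(1-γ) dt` is well defined for `x > 0`,
twice continuously differentiable on `(0,∞)`, and satisfies
`β₁ x u''(x) + (λ x + β₁ ξ*) u'(x) - λ(γ-2) u(x) = 0` for all `x > 0`. -/
theorem laplace_ode_solution (lam β₁ γ ξs : ℝ) (hlam : 0 < lam) (hβ₁ : 0 < β₁)
    (hpos : 0 < ξs + γ - 2)
    (u : ℝ → ℝ)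
    (hu : u = fun x : ℝ =>
      ∫ t in Set.Ioi (1:ℝ), Real.exp (-(lam * x * t) / β₁) * (t - 1) ^ (ξs + γ - 3) * t ^ (1 - γ)) :
    (∀ x : ℝ, 0 < x → IntegrableOn
      (fun t : ℝ => Real.exp (-(lam * x * t) / β₁) * (t - 1) ^ (ξs + γ - 3) * t ^ (1 - γ))
      (Set.Ioi 1)) ∧
    ContDiffOn ℝ 2 u (Set.Ioi 0) ∧
    ∀ x : ℝ, 0 < x →
      β₁ * x * deriv (deriv u) x + (lam * x + β₁ * ξs) * deriv u x - lam * (γ - 2) * u x = 0 := by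

  have hs : -1 < ξs + γ - 3 := by linarith
  have huJ : u = lapJ lam β₁ (ξs + γ - 3) (1 - γ) := hu
  refine ⟨fun x hx => lapK_int lam β₁ (ξs + γ - 3) (1 - γ) x hlam hβ₁ hs hx, ?_, ?_⟩
  · rw [huJ]
    exact_mod_cast lapJ_contDiff lam β₁ _ hlam hβ₁ hs 2 (1 - γ)
  · intro x hx
    have d1 : ∀ y, 0 < y → deriv u y =
        -(lam/β₁) * lapJ lam β₁ (ξs + γ - 3) (1 - γ + 1) y := fun y hy => by
      rw [huJ]; exact (lapJ_deriv lam β₁ _ _ y hlam hβ₁ hs hy).deriv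
    have d2 : deriv (deriv u) x =
        -(lam/β₁) * (-(lam/β₁) * lapJ lam β₁ (ξs + γ - 3) (1 - γ + 1 + 1) x) := by
      have he : deriv u =ᶠ[nhds x]
          fun y => -(lam/β₁) * lapJ lam β₁ (ξs + γ - 3) (1 - γ + 1) y := by
        filter_upwards [Ioi_mem_nhds hx] with y hy using d1 y hy
      rw [he.deriv_eq]
      exact ((lapJ_deriv lam β₁ _ _ x hlam hβ₁ hs hx).const_mul _).deriv
    have hp := lap_parts lam β₁ (ξs + γ - 3) (1 - γ) x hlam hβ₁ hs hx
    rw [d2, d1 x hx, huJ]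
    generalize lapJ lam β₁ (ξs + γ - 3) (1 - γ + 1 + 1) x = A at *
    generalize lapJ lam β₁ (ξs + γ - 3) (1 - γ + 1) x = B at *
    generalize lapJ lam β₁ (ξs + γ - 3) (1 - γ) x = D at *
    have hb : β₁ ≠ 0 := hβ₁.ne'
    field_simp at hp ⊢
    linear_combination (-lam) * hp
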